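/- arXiv:2604.18400 — 10 statements merged into one kernel-verified Lean document; each statement's English description precedes it below -/
import Mathlib

section
/- If (X,d) is a finite ultrametric space and D(X) = {d(x,y) : x,y ∈ X} is its distance set, then |D(X)| ≤ |X|. -/
open Classical in
/-- The points of a finite subset `s` of an ultrametric space realise at most `s.card` distances. -/
theorem card_image_dist_le_card {X : Type*} (d : X → X → NNReal)
    (hsymm : ∀ x y, d x y = d y x)
    (hself : ∀ x, d x x = 0)
    (htri : ∀ x y z, d x y ≤ max (d x z) (d z y)) (s : Finset X) :
    ((s ×ˢ s).image fun p => d p.1 p.2).card ≤ s.card := by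
  induction s using Finset.induction_on with
  | empty => simp
  | insert a s ha ih =>
    rcases s.eq_empty_or_nonempty with rfl | hs
    · simp
    · -- The only possibly new distance is the one from `a` to its nearest point in `s`.
      obtain ⟨p, hp, hmin⟩ := s.exists_min_image (d a) hs
      have key : ∀ x ∈ s, d a x = d a p ∨ d a x = d p x := by
        intro x hx
        have h1 := hmin x hx
        have h2 := htri a x p
        have h3 := htri p x a
        rw [hsymm p a, max_eq_right h1] at h3
        rcases le_max_iff.1 h2 with h | h
        · exact Or.inl (le_antisymm h h1)
        · exact Or.inr (le_antisymm h h3)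
      have hsub : ((insert a s ×ˢ insert a s).image fun p => d p.1 p.2) ⊆
          insert (d a p) ((s ×ˢ s).image fun p => d p.1 p.2) := by
        intro r hr
        simp only [Finset.mem_image, Finset.mem_product, Finset.mem_insert, Prod.exists] at hr ⊢
        obtain ⟨x, y, ⟨hx, hy⟩, rfl⟩ := hr
        rcases hx with rfl | hx <;> rcases hy with rfl | hy
        · exact Or.inr ⟨p, p, ⟨hp, hp⟩, by simp only [hself]⟩
        · exact (key y hy).imp_right fun h => ⟨p, y, ⟨hp, hy⟩, h.symm⟩
        · rw [hsymm x]
          exact (key x hx).imp_right fun h => ⟨p, x, ⟨hp, hx⟩, h.symm⟩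
        · exact Or.inr ⟨x, y, ⟨hx, hy⟩, rfl⟩
      rw [Finset.card_insert_of_notMem ha]
      exact (Finset.card_le_card hsub).trans
        ((Finset.card_insert_le _ _).trans (Nat.succ_le_succ ih))

/-- If (X,d) is a finite ultrametric space and
D(X) = {d(x,y) : x,y ∈ X} is its distance set, then |D(X)| ≤ |X|. -/
theorem gomory_hu_inequality {X : Type*} [Fintype X] (d : X → X → NNReal)
    (hsymm : ∀ x y, d x y = d y x)
    (hzero : ∀ x y, d x y = 0 ↔ x = y)
    (htri : ∀ x y z, d x y ≤ max (d x z) (d z y)) :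
    {r : NNReal | ∃ x y, d x y = r}.ncard ≤ Fintype.card X := by
  classical
  have hset : {r : NNReal | ∃ x y, d x y = r} =
      ((Finset.univ ×ˢ Finset.univ).image fun p : X × X => d p.1 p.2 : Finset NNReal) := by
    ext r
    simp
  rw [hset, Set.ncard_coe_finset, ← Finset.card_univ]
  convert card_image_dist_le_card d hsymm (fun x => (hzero x x).2 rfl) htri Finset.univ
end

section
/- Let G(w) be a weighted graph with weight w : E(G) → ℝ≥0. The weight w is pseudoultrametrizable (i.e., there exists a pseudoultrametric ρ on V(G) with ρ(x,y) = w({x,y}) for every edge {x,y} ∈ E(G)) if and only if for every cycle C ⊆ G there exist two distinct edges e₁, e₂ ∈ E(C) with w(e₁) = w(e₂) = max_{e ∈ E(C)} w(e). Moreover, if G is connected and w is pseudoultrametrizable, then the function ρ_w defined by ρ_w(x,x) = 0 and, for x ≠ y, ρ_w(x,y) = inf over all paths P joining x and y in G of (max_{e ∈ E(P)} w(e)), is a pseudoultrametric on V(G) satisfying ρ_w(x,y) = w({x,y}) for every edge {x,y} ∈ E(G). -/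
/-- A pseudoultrametric on `X`. -/
def IsPseudoUltrametric {X : Type*} (d : X → X → NNReal) : Prop :=
  (∀ x, d x x = 0) ∧ (∀ x y, d x y = d y x) ∧
    ∀ x y z, d x y ≤ max (d x z) (d z y)

/-- The weight `w` is pseudoultrametrizable: some pseudoultrametric on `V(G)`
agrees with `w` on the edges of `G`. -/
def IsPseudoultrametrizable {V : Type*} (G : SimpleGraph V)
    (w : Sym2 V → NNReal) : Prop :=
  ∃ ρ : V → V → NNReal, IsPseudoUltrametric ρ ∧
    ∀ x y : V, G.Adj x y → ρ x y = w s(x, y)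

open Classical in
/-- The "ultrametric shortest path" function `ρ_w`:
`ρ_w x y = inf over paths P joining x and y of (max_{e ∈ E(P)} w e)`. -/
noncomputable def rhoW {V : Type*} (G : SimpleGraph V) (w : Sym2 V → NNReal)
    (x y : V) : NNReal :=
  if x = y then 0
  else ⨅ p : {p : G.Walk x y // p.IsPath}, (p.1.edges.map w).foldr max 0

/-- The largest weight of an edge of a walk, `0` for the empty walk. -/
noncomputable def walkMax {V : Type*} {G : SimpleGraph V} (w : Sym2 V → NNReal) {x y : V}
    (p : G.Walk x y) : NNReal :=
  (p.edges.map w).foldr max 0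

section

variable {V : Type*} {G : SimpleGraph V} {w : Sym2 V → NNReal}

theorem walkMax_le_iff {x y : V} {p : G.Walk x y} {c : NNReal} :
    walkMax w p ≤ c ↔ ∀ e ∈ p.edges, w e ≤ c := by
  unfold walkMax
  induction p.edges with
  | nil => simp
  | cons a l ih => simp [ih]

theorem le_walkMax {x y : V} (p : G.Walk x y) {e : Sym2 V} (he : e ∈ p.edges) :
    w e ≤ walkMax w p :=
  walkMax_le_iff.1 le_rfl e he

theorem rhoW_le_walkMax {x y : V} (p : G.Walk x y) : rhoW G w x y ≤ walkMax w p := by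
  classical
  unfold rhoW
  split_ifs with h
  · exact zero_le
  · refine (ciInf_le' _ (⟨p.bypass, p.bypass_isPath⟩ : {p : G.Walk x y // p.IsPath})).trans ?_
    exact walkMax_le_iff.2 fun e he => le_walkMax p (p.edges_bypass_subset_edges he)

theorem exists_isPath_walkMax_lt {x y : V} (hr : G.Reachable x y) {c : NNReal}
    (hc : rhoW G w x y < c) : ∃ p : G.Walk x y, p.IsPath ∧ walkMax w p < c := by
  classical
  unfold rhoW at hc
  split_ifs at hc with h
  · subst h
    exact ⟨.nil, .nil, by simpa [walkMax] using hc⟩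
  · obtain ⟨q⟩ := hr
    have : Nonempty {p : G.Walk x y // p.IsPath} := ⟨⟨q.bypass, q.bypass_isPath⟩⟩
    obtain ⟨p, hp⟩ := exists_lt_of_ciInf_lt hc
    exact ⟨p.1, p.2, hp⟩

theorem rhoW_self (x : V) : rhoW G w x x = 0 := by
  simp [rhoW]

theorem rhoW_comm_le {x y : V} (hr : G.Reachable x y) : rhoW G w y x ≤ rhoW G w x y := by
  refine le_of_forall_gt fun c hc => ?_
  obtain ⟨p, -, hp⟩ := exists_isPath_walkMax_lt hr hc
  refine (rhoW_le_walkMax p.reverse).trans_lt (lt_of_le_of_lt ?_ hp)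
  exact walkMax_le_iff.2 fun e he => le_walkMax p (by simpa using he)

theorem rhoW_comm {x y : V} (hr : G.Reachable x y) : rhoW G w x y = rhoW G w y x :=
  le_antisymm (rhoW_comm_le hr.symm) (rhoW_comm_le hr)

theorem rhoW_triangle {x y z : V} (hxz : G.Reachable x z) (hzy : G.Reachable z y) :
    rhoW G w x y ≤ max (rhoW G w x z) (rhoW G w z y) := by
  refine le_of_forall_gt fun c hc => ?_
  obtain ⟨p, -, hp⟩ := exists_isPath_walkMax_lt hxz ((le_max_left _ _).trans_lt hc)
  obtain ⟨q, -, hq⟩ := exists_isPath_walkMax_lt hzy ((le_max_right _ _).trans_lt hc)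
  refine (rhoW_le_walkMax (p.append q)).trans_lt (lt_of_le_of_lt ?_ (max_lt hp hq))
  refine walkMax_le_iff.2 fun e he => ?_
  rw [SimpleGraph.Walk.edges_append, List.mem_append] at he
  exact he.elim (fun h => le_max_of_le_left (le_walkMax p h))
    fun h => le_max_of_le_right (le_walkMax q h)

theorem rhoW_eq_weight {x y : V} (hxy : G.Adj x y)
    (h : ∀ p : G.Walk x y, p.IsPath → w s(x, y) ≤ walkMax w p) :
    rhoW G w x y = w s(x, y) := by
  apply le_antisymm
  · refine (rhoW_le_walkMax hxy.toWalk).trans (walkMax_le_iff.2 fun e he => ?_)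
    have : e = s(x, y) := by simpa using he
    rw [this]
  · by_contra! hlt
    obtain ⟨p, hpath, hp⟩ := exists_isPath_walkMax_lt hxy.reachable hlt
    exact (h p hpath).not_gt hp

theorem weight_le_walkMax_of_cycle_condition
    (hcyc : ∀ (x : V) (c : G.Walk x x), c.IsCycle →
      ∃ e₁ ∈ c.edges, ∃ e₂ ∈ c.edges, e₁ ≠ e₂ ∧ w e₁ = w e₂ ∧ ∀ e ∈ c.edges, w e ≤ w e₁)
    {x y : V} (hxy : G.Adj x y) {p : G.Walk x y} (hp : p.IsPath) :
    w s(x, y) ≤ walkMax w p := by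
  by_cases hmem : s(x, y) ∈ p.edges
  · exact le_walkMax p hmem
  have hc : (SimpleGraph.Walk.cons hxy.symm p).IsCycle := by
    rw [SimpleGraph.Walk.cons_isCycle_iff]
    exact ⟨hp, by rwa [Sym2.eq_swap]⟩
  obtain ⟨e₁, h₁, e₂, h₂, hne, heq, hmax⟩ := hcyc y _ hc
  have hle := hmax s(y, x) (by simp)
  rw [Sym2.eq_swap] at hle
  rw [SimpleGraph.Walk.edges_cons, List.mem_cons] at h₁ h₂
  rcases h₁ with h₁ | h₁
  · rcases h₂ with h₂ | h₂
    · exact absurd (h₁.trans h₂.symm) hne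
    · exact (hle.trans_eq heq).trans (le_walkMax p h₂)
  · exact hle.trans (le_walkMax p h₁)

theorem IsPseudoUltrametric.le_walkMax {ρ : V → V → NNReal} (hρ : IsPseudoUltrametric ρ)
    (hw : ∀ x y : V, G.Adj x y → ρ x y = w s(x, y)) {x y : V} (p : G.Walk x y) :
    ρ x y ≤ walkMax w p := by
  induction p with
  | nil => simp [hρ.1]
  | @cons x z y h p ih =>
    refine (hρ.2.2 x y z).trans (max_le ?_ (ih.trans ?_))
    · rw [hw _ _ h]
      exact _root_.le_walkMax (.cons h p) (by simp)
    · exact walkMax_le_iff.2 fun e he => _root_.le_walkMax (.cons h p) (by simp [he])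

theorem IsPseudoUltrametric.weight_le_of_forall_lt {ρ : V → V → NNReal}
    (hρ : IsPseudoUltrametric ρ) (hw : ∀ x y : V, G.Adj x y → ρ x y = w s(x, y))
    {e : Sym2 V} (hpos : 0 < w e) {x y : V} (p : G.Walk x y) (hnd : p.edges.Nodup)
    (he : e ∈ p.edges) (hlt : ∀ f ∈ p.edges, f ≠ e → w f < w e) : w e ≤ ρ x y := by
  induction p with
  | nil => simp at he
  | @cons x z y h p ih =>
    rw [SimpleGraph.Walk.edges_cons, List.nodup_cons] at hnd
    by_cases hez : s(x, z) = e
    · have hzy : ρ z y < w e := by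
        refine (hρ.le_walkMax hw p).trans_lt ?_
        have hall : ∀ f ∈ p.edges, w f < w e := fun f hf =>
          hlt f (by simp [hf]) fun hfe => hnd.1 (by rwa [hez, ← hfe])
        unfold walkMax
        revert hall
        induction p.edges with
        | nil => simpa using hpos
        | cons a l ih => intro hall; simp_all
      have := hρ.2.2 x z y
      rw [hw _ _ h, hez, hρ.2.1 y z] at this
      exact (le_max_iff.1 this).resolve_right hzy.not_ge
    · have he' : e ∈ p.edges := by
        rw [SimpleGraph.Walk.edges_cons, List.mem_cons] at he
        exact he.resolve_left (Ne.symm hez)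
      have hle := ih hnd.2 he' fun f hf => hlt f (by simp [hf])
      have hxz : ρ z x < w e := by
        rw [hρ.2.1, hw _ _ h]
        exact hlt _ (by simp) hez
      exact (le_max_iff.1 (hle.trans (hρ.2.2 z y x))).resolve_left hxz.not_ge

theorem IsPseudoultrametrizable.cycle_condition (h : IsPseudoultrametrizable G w) {x : V}
    {c : G.Walk x x} (hc : c.IsCycle) :
    ∃ e₁ ∈ c.edges, ∃ e₂ ∈ c.edges, e₁ ≠ e₂ ∧ w e₁ = w e₂ ∧ ∀ e ∈ c.edges, w e ≤ w e₁ := by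
  classical
  obtain ⟨ρ, hρ, hw⟩ := h
  have hcard : c.edges.toFinset.card = c.length := by
    rw [List.toFinset_card_of_nodup hc.isTrail.edges_nodup, SimpleGraph.Walk.length_edges]
  have hlen := hc.three_le_length
  obtain ⟨e₁, h₁, hmax⟩ := c.edges.toFinset.exists_max_image w
    (Finset.card_pos.1 (by omega))
  obtain ⟨f, hf, hfe⟩ := Finset.exists_mem_ne (s := c.edges.toFinset) (by omega) e₁
  simp only [List.mem_toFinset] at h₁ hmax hf
  refine ⟨e₁, h₁, ?_⟩
  by_contra! hcon
  have hlt : ∀ f ∈ c.edges, f ≠ e₁ → w f < w e₁ := fun f hf hne =>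
    lt_of_le_of_ne (hmax f hf) fun heq => by
      obtain ⟨e, he, hlt⟩ := hcon f hf hne.symm heq.symm
      exact (hmax e he).not_gt hlt
  have hpos : 0 < w e₁ := zero_le.trans_lt (hlt f hf hfe)
  have := hρ.weight_le_of_forall_lt hw hpos c hc.isTrail.edges_nodup h₁ hlt
  rw [hρ.1] at this
  exact this.not_gt hpos

/-- A function that is an ultrametric on each class of an equivalence relation extends to a
pseudoultrametric, by joining the classes at base points. -/
theorem exists_isPseudoUltrametric_extension {X : Type*} (r : Setoid X) {d : X → X → NNReal}
    (hself : ∀ x, d x x = 0) (hcomm : ∀ x y, r x y → d x y = d y x)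
    (htri : ∀ x y z, r x z → r z y → d x y ≤ max (d x z) (d z y)) :
    ∃ ρ : X → X → NNReal, IsPseudoUltrametric ρ ∧ ∀ x y, r x y → ρ x y = d x y := by
  classical
  let b : X → X := fun x => (Quotient.mk r x).out
  have hb : ∀ x, r x (b x) := fun x => r.symm (Quotient.mk_out x)
  have hbeq : ∀ x y, r x y → b x = b y := fun x y h =>
    congrArg Quotient.out (Quotient.sound h)
  have hbase : ∀ x y, r x y → d x (b x) ≤ max (d x y) (d y (b y)) := fun x y h => by
    rw [hbeq x y h]
    exact htri x (b y) y h (hb y)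
  have hmax : ∀ x y, r x y → d x y ≤ max (d x (b x)) (d y (b y)) := fun x y h => by
    have := htri x y (b x) (hb x) (r.trans (r.symm (hb x)) h)
    rw [hcomm (b x) y (r.trans (r.symm (hb x)) h)] at this
    rwa [← hbeq x y h]
  refine ⟨fun x y => if r x y then d x y else max (d x (b x)) (d y (b y)), ⟨?_, ?_, ?_⟩, ?_⟩
  · intro x
    simp [hself]
  · intro x y
    by_cases h : r x y
    · simp [h, r.symm h, hcomm x y h]
    · have h' : ¬ r y x := fun h' => h (r.symm h')
      simp [h, h', max_comm]
  · intro x y z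
    by_cases hxz : r x z
    · by_cases hzy : r z y
      · simpa [hxz, hzy, r.trans hxz hzy] using htri x y z hxz hzy
      · have hxy : ¬ r x y := fun h => hzy (r.trans (r.symm hxz) h)
        have := hbase x z hxz
        simp only [hxz, hzy, hxy, if_true, if_false]
        grind
    · by_cases hzy : r z y
      · have hxy : ¬ r x y := fun h => hxz (r.trans h (r.symm hzy))
        have := hbase y z (r.symm hzy)
        rw [← hcomm z y hzy] at this
        simp only [hxz, hzy, hxy, if_true, if_false]
        grind
      · have := hmax x y
        simp only [hxz, hzy, if_false]
        split_ifs <;> grind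
  · intro x y h
    simp [h]

end

/-- `w` is pseudoultrametrizable iff every cycle `C ⊆ G` has two
distinct edges of maximal weight; moreover, if `G` is connected and `w` is
pseudoultrametrizable, then `ρ_w` is a pseudoultrametric on `V(G)` agreeing
with `w` on edges. -/
theorem pseudoultrametrizable_iff_cycle_condition {V : Type*}
    (G : SimpleGraph V) (w : Sym2 V → NNReal) :
    (IsPseudoultrametrizable G w ↔
      ∀ (x : V) (c : G.Walk x x), c.IsCycle →
        ∃ e₁ ∈ c.edges, ∃ e₂ ∈ c.edges, e₁ ≠ e₂ ∧ w e₁ = w e₂ ∧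
          ∀ e ∈ c.edges, w e ≤ w e₁) ∧
    (G.Connected → IsPseudoultrametrizable G w →
      IsPseudoUltrametric (rhoW G w) ∧
        ∀ x y : V, G.Adj x y → rhoW G w x y = w s(x, y)) := by
  refine ⟨⟨fun h x c hc => h.cycle_condition hc, fun hcyc => ?_⟩,
    fun hconn h => ⟨⟨?_, ?_, ?_⟩, ?_⟩⟩
  · obtain ⟨ρ, hρ, heq⟩ := exists_isPseudoUltrametric_extension G.reachableSetoid
      (d := rhoW G w) rhoW_self (fun _ _ => rhoW_comm) fun _ _ _ => rhoW_triangle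
    refine ⟨ρ, hρ, fun x y hxy => (heq x y hxy.reachable).trans ?_⟩
    exact rhoW_eq_weight hxy fun p hp => weight_le_walkMax_of_cycle_condition hcyc hxy hp
  · exact rhoW_self
  · exact fun x y => rhoW_comm (hconn x y)
  · exact fun x y z => rhoW_triangle (hconn x z) (hconn z y)
  · obtain ⟨ρ, hρ, hw⟩ := h
    exact fun x y hxy => rhoW_eq_weight hxy fun p _ => hw x y hxy ▸ hρ.le_walkMax hw p
end

section
/- Let T be a tree with a vertex labeling l : V(T) → ℝ≥0, and let d_l : V(T) × V(T) → ℝ≥0 be defined by d_l(x,x) = 0 and, for x ≠ y, d_l(x,y) = max_{v ∈ V(P)} l(v), where P is the unique path in T joining x and y. Then d_l is an ultrametric on V(T) if and only if max{l(u), l(v)} > 0 holds for every edge {u,v} ∈ E(T). -/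
open Classical in
/-- The distance `d_l` generated by a labeled graph `G(l)`:
`d_l x x = 0` and, for `x ≠ y`,
`d_l x y = inf over paths P joining x and y of (max_{v ∈ V(P)} l v)`.
(In a tree the path joining `x` and `y` is unique, so for a tree this is
`max_{v ∈ V(P)} l v` over the unique path `P`.) -/
noncomputable def labelDist {V : Type*} (G : SimpleGraph V) (l : V → NNReal)
    (x y : V) : NNReal :=
  if x = y then 0
  else ⨅ p : {p : G.Walk x y // p.IsPath}, (p.1.support.map l).foldr max 0

theorem List.foldr_max_zero_le_iff (L : List NNReal) (c : NNReal) :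
    L.foldr max 0 ≤ c ↔ ∀ a ∈ L, a ≤ c := by
  induction L with
  | nil => simp
  | cons a L ih => simp [ih]

/-- In an acyclic graph, `labelDist` is the maximal label on the path joining the two vertices. -/
theorem SimpleGraph.IsAcyclic.labelDist_le_iff {V : Type*} {T : SimpleGraph V}
    (hT : T.IsAcyclic) (l : V → NNReal) {x y : V} (hxy : x ≠ y) {p : T.Walk x y} (hp : p.IsPath)
    (c : NNReal) : labelDist T l x y ≤ c ↔ ∀ v ∈ p.support, l v ≤ c := by
  have : Subsingleton {p : T.Walk x y // p.IsPath} := hT.subsingleton_path x y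
  rw [labelDist, if_neg hxy, ciInf_subsingleton ⟨p, hp⟩, List.foldr_max_zero_le_iff]
  simp

theorem SimpleGraph.IsAcyclic.labelDist_le_of_walk {V : Type*} {T : SimpleGraph V}
    (hT : T.IsAcyclic) (l : V → NNReal) {x y : V} (p : T.Walk x y) {c : NNReal}
    (h : ∀ v ∈ p.support, l v ≤ c) : labelDist T l x y ≤ c := by
  classical
  rcases eq_or_ne x y with rfl | hxy
  · simp [labelDist]
  · exact (hT.labelDist_le_iff l hxy p.bypass_isPath c).2
      fun v hv => h v (p.support_bypass_subset_support hv)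

theorem SimpleGraph.IsTree.labelDist_le_symm {V : Type*} {T : SimpleGraph V}
    (hT : T.IsTree) (l : V → NNReal) (x y : V) : labelDist T l x y ≤ labelDist T l y x := by
  rcases eq_or_ne y x with rfl | hyx
  · rfl
  · obtain ⟨p, hp⟩ := hT.connected.exists_isPath y x
    refine hT.isAcyclic.labelDist_le_of_walk l p.reverse fun v hv => ?_
    exact (hT.isAcyclic.labelDist_le_iff l hyx hp _).1 le_rfl v (by simpa using hv)

theorem SimpleGraph.IsTree.labelDist_le_max {V : Type*} {T : SimpleGraph V}
    (hT : T.IsTree) (l : V → NNReal) (x y z : V) :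
    labelDist T l x y ≤ max (labelDist T l x z) (labelDist T l z y) := by
  rcases eq_or_ne x z with rfl | hxz
  · exact le_max_right _ _
  rcases eq_or_ne z y with rfl | hzy
  · exact le_max_left _ _
  obtain ⟨p, hp⟩ := hT.connected.exists_isPath x z
  obtain ⟨q, hq⟩ := hT.connected.exists_isPath z y
  refine hT.isAcyclic.labelDist_le_of_walk l (p.append q) fun v hv => ?_
  rcases (p.mem_support_append_iff q).1 hv with hv | hv
  · exact le_max_of_le_left ((hT.isAcyclic.labelDist_le_iff l hxz hp _).1 le_rfl v hv)
  · exact le_max_of_le_right ((hT.isAcyclic.labelDist_le_iff l hzy hq _).1 le_rfl v hv)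

/-- For a labeled tree `T(l)`, the function `d_l` is an
ultrametric on `V(T)` iff `max {l u, l v} > 0` for every edge `{u,v} ∈ E(T)`. -/
theorem labelDist_ultrametric_iff_of_tree {V : Type*} (T : SimpleGraph V)
    (hT : T.IsTree) (l : V → NNReal) :
    ((∀ x y, labelDist T l x y = labelDist T l y x) ∧
     (∀ x y, labelDist T l x y = 0 ↔ x = y) ∧
     (∀ x y z, labelDist T l x y ≤ max (labelDist T l x z) (labelDist T l z y)))
      ↔ ∀ u v : V, T.Adj u v → 0 < max (l u) (l v) := by
  constructor
  · rintro ⟨-, hzero, -⟩ u v huv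
    by_contra! h
    refine huv.ne ((hzero u v).1 (nonpos_iff_eq_zero.1 ?_))
    refine hT.isAcyclic.labelDist_le_of_walk l huv.toWalk fun w hw => ?_
    have hw : w = u ∨ w = v := by simpa using hw
    rcases hw with rfl | rfl
    · exact (le_max_left _ _).trans h
    · exact (le_max_right _ _).trans h
  · refine fun h => ⟨fun x y => (hT.labelDist_le_symm l x y).antisymm (hT.labelDist_le_symm l y x),
      fun x y => ⟨fun hd => ?_, fun hxy => by simp [labelDist, hxy]⟩, hT.labelDist_le_max l⟩
    by_contra hxy
    obtain ⟨p, hp⟩ := hT.connected.exists_isPath x y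
    have hl := (hT.isAcyclic.labelDist_le_iff l hxy hp 0).1 hd.le
    cases p with
    | nil => exact hxy rfl
    | cons hadj q => exact (h _ _ hadj).not_ge (max_le (hl _ (by simp)) (hl _ (by simp)))
end

section
/- Let T be a finite tree with |V(T)| ≥ 2 and a non-degenerate vertex labeling l : V(T) → ℝ≥0, let w({u,v}) = max{l(u), l(v)} for each edge {u,v} ∈ E(T), and let d_l be the ultrametric generated by T(l). Then the following statements are equivalent: (i) |D(V(T))| = |V(T)| (i.e., (V(T), d_l) is a GH-space); (ii) the mapping w : E(T) → ℝ≥0 is injective; (iii) |D(V(T))| = |E(T)| + 1; (iv) 2|D(V(T))| = 2 + Σ_{v ∈ V(T)} deg_T(v), where D(V(T)) is the distance set of (V(T), d_l). -/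
/-- The distance set `D(X) = {d(x,y) : x,y ∈ X}`. -/
def distSet {X : Type*} (d : X → X → NNReal) : Set NNReal :=
  {r | ∃ x y, d x y = r}

/-- The weight `w({u,v}) = max {l u, l v}` on unordered pairs. -/
noncomputable def wmax {V : Type*} (l : V → NNReal) : Sym2 V → NNReal :=
  Sym2.lift ⟨fun u v => max (l u) (l v), fun u v => max_comm (l u) (l v)⟩

/-- Along a walk with at least one edge, the maximum of the vertex labels is the weight of some
edge. -/
theorem SimpleGraph.Walk.exists_mem_edges_wmax_eq {V : Type*} {G : SimpleGraph V}
    (l : V → NNReal) {x y : V} (p : G.Walk x y) (hp : ¬ p.Nil) :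
    ∃ e ∈ p.edges, wmax l e = (p.support.map l).foldr max 0 := by
  induction p with
  | nil => simp at hp
  | @cons u v w h p ih =>
    by_cases hn : p.Nil
    · cases hn
      exact ⟨s(u, v), by simp, by simp [wmax]⟩
    · obtain ⟨e, he, hwe⟩ := ih hn
      have hv : l v ≤ (p.support.map l).foldr max 0 := by
        cases p <;> simp
      simp only [support_cons, List.map_cons, List.foldr_cons, edges_cons, List.mem_cons]
      rcases le_total (l u) ((p.support.map l).foldr max 0) with hle | hle
      · exact ⟨e, Or.inr he, by rw [hwe, max_eq_right hle]⟩
      · refine ⟨s(u, v), Or.inl rfl, ?_⟩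
        rw [max_eq_left hle]
        exact max_eq_left (hv.trans hle)

/-- In an acyclic graph `labelDist` is computed by any path between two distinct vertices. -/
theorem labelDist_eq_of_isPath {V : Type*} {G : SimpleGraph V} (hG : G.IsAcyclic)
    (l : V → NNReal) {x y : V} (hxy : x ≠ y) {p : G.Walk x y} (hp : p.IsPath) :
    labelDist G l x y = (p.support.map l).foldr max 0 := by
  rw [labelDist, if_neg hxy]
  have : Subsingleton {p : G.Walk x y // p.IsPath} := hG.subsingleton_path x y
  exact ciInf_subsingleton (⟨p, hp⟩ : {p : G.Walk x y // p.IsPath}) _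

/-- In an acyclic graph the distance between adjacent vertices is the weight of their edge. -/
theorem labelDist_eq_wmax_of_adj {V : Type*} {G : SimpleGraph V} (hG : G.IsAcyclic)
    (l : V → NNReal) {x y : V} (h : G.Adj x y) : labelDist G l x y = wmax l s(x, y) := by
  have hp : h.toWalk.IsPath := by simp [h.ne]
  rw [labelDist_eq_of_isPath hG l h.ne hp]
  simp [wmax]

/-- The nonzero distances of a labeled tree are weights of edges, and conversely. -/
theorem distSet_labelDist_eq_insert {V : Type*} {T : SimpleGraph V} (hT : T.IsTree)
    (l : V → NNReal) : distSet (labelDist T l) = insert 0 (wmax l '' T.edgeSet) := by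
  ext r
  constructor
  · rintro ⟨x, y, rfl⟩
    by_cases hxy : x = y
    · left
      simp [labelDist, hxy]
    · right
      obtain ⟨p, hp, -⟩ := hT.existsUnique_path x y
      obtain ⟨e, he, hwe⟩ :=
        p.exists_mem_edges_wmax_eq l (SimpleGraph.Walk.not_nil_of_ne hxy)
      exact ⟨e, p.edges_subset_edgeSet he, by
        rw [labelDist_eq_of_isPath hT.isAcyclic l hxy hp, hwe]⟩
  · rintro (rfl | ⟨e, he, rfl⟩)
    · obtain ⟨x⟩ := hT.connected.nonempty
      exact ⟨x, x, by simp [labelDist]⟩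
    · induction e with
      | h x y => exact ⟨x, y, labelDist_eq_wmax_of_adj hT.isAcyclic l he⟩

/-- Let `T` be a finite tree with `|V(T)| ≥ 2` and a
non-degenerate labeling `l`, let `w({u,v}) = max {l u, l v}` on edges, and let
`d_l` be the ultrametric generated by `T(l)`.  TFAE:
(i) `|D(V(T))| = |V(T)|` (GH-space);
(ii) `w` is injective on `E(T)`;
(iii) `|D(V(T))| = |E(T)| + 1`;
(iv) `2|D(V(T))| = 2 + Σ_v deg_T(v)`. -/
theorem GH_space_tfae_of_tree {V : Type*} [Fintype V] (T : SimpleGraph V)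
    [DecidableRel T.Adj] (hT : T.IsTree) (hcard : 2 ≤ Fintype.card V)
    (l : V → NNReal) (hnd : ∀ u v : V, T.Adj u v → 0 < max (l u) (l v)) :
    List.TFAE
      [(distSet (labelDist T l)).ncard = Fintype.card V,
       Set.InjOn (wmax l) T.edgeSet,
       (distSet (labelDist T l)).ncard = T.edgeSet.ncard + 1,
       2 * (distSet (labelDist T l)).ncard = 2 + ∑ v : V, T.degree v] := by
  classical
  have hzero : (0 : NNReal) ∉ wmax l '' T.edgeSet := by
    rintro ⟨e, he, h0⟩
    induction e with
    | h x y => exact (hnd x y he).ne' h0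
  have hdist : (distSet (labelDist T l)).ncard = (wmax l '' T.edgeSet).ncard + 1 := by
    rw [distSet_labelDist_eq_insert hT, Set.ncard_insert_of_notMem hzero (Set.toFinite _)]
  have hedge : T.edgeSet.ncard = T.edgeFinset.card := by
    rw [← SimpleGraph.coe_edgeFinset, Set.ncard_coe_finset]
  have hV : T.edgeFinset.card + 1 = Fintype.card V := hT.card_edgeFinset
  have hdeg : ∑ v : V, T.degree v = 2 * T.edgeFinset.card := T.sum_degrees_eq_twice_card_edges
  have hinj : Set.InjOn (wmax l) T.edgeSet ↔
      (wmax l '' T.edgeSet).ncard = T.edgeSet.ncard :=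
    (Set.ncard_image_iff (Set.toFinite _)).symm
  tfae_have 1 ↔ 3 := by omega
  tfae_have 2 ↔ 3 := by rw [hinj]; omega
  tfae_have 3 ↔ 4 := by omega
  tfae_finish
end

section
/- Let T be a finite tree. Then there exists a non-degenerate vertex labeling l : V(T) → ℝ≥0 such that (V(T), d_l) is a GH-space (i.e., |D(V(T))| = |V(T)|), and moreover d_l(x,y) = max{l(x), l(y)} holds for any two distinct vertices x, y ∈ V(T), where d_l is the ultrametric generated by T(l). -/
/-- If every vertex can be joined to `r` by a walk on which the labels never exceed the label of
the starting vertex, then `labelDist` is the maximum of the labels of the end points. -/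
theorem labelDist_eq_max_of_walks {V : Type*} {G : SimpleGraph V} {l : V → NNReal} {r : V}
    (h : ∀ x, ∃ w : G.Walk x r, ∀ z ∈ w.support, l z ≤ l x) {x y : V} (hxy : x ≠ y) :
    labelDist G l x y = max (l x) (l y) := by
  classical
  obtain ⟨u, hu⟩ := h x
  obtain ⟨v, hv⟩ := h y
  let p : {p : G.Walk x y // p.IsPath} := (u.append v.reverse).toPath
  have : Nonempty {p : G.Walk x y // p.IsPath} := ⟨p⟩
  rw [labelDist, if_neg hxy]
  apply le_antisymm
  · refine (ciInf_le (OrderBot.bddBelow _) p).trans ?_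
    rw [List.foldr_max_zero_le_iff]
    intro a ha
    obtain ⟨z, hz, rfl⟩ := List.mem_map.1 ha
    have hz' := SimpleGraph.Walk.support_toPath_subset_support _ hz
    rw [SimpleGraph.Walk.mem_support_append_iff, SimpleGraph.Walk.support_reverse,
      List.mem_reverse] at hz'
    exact hz'.elim (fun hz => le_max_of_le_left (hu z hz)) fun hz => le_max_of_le_right (hv z hz)
  · refine le_ciInf fun q => ?_
    have hq := (List.foldr_max_zero_le_iff (q.1.support.map l) _).1 le_rfl
    exact max_le (hq _ (List.mem_map_of_mem q.1.start_mem_support))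
      (hq _ (List.mem_map_of_mem q.1.end_mem_support))

/-- Vertices of a shortest walk to `r`, other than its start, are strictly closer to `r`. -/
theorem SimpleGraph.Connected.exists_walk_dist_lt {V : Type*} {G : SimpleGraph V}
    (hG : G.Connected) (r x : V) :
    ∃ w : G.Walk x r, ∀ z ∈ w.support, z = x ∨ G.dist z r < G.dist x r := by
  classical
  obtain ⟨w, hw⟩ := hG.exists_walk_length_eq_dist x r
  refine ⟨w, fun z hz => or_iff_not_imp_left.2 fun hzx => ?_⟩
  have hlen := congrArg SimpleGraph.Walk.length (w.take_spec hz)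
  rw [SimpleGraph.Walk.length_append] at hlen
  have hdrop := SimpleGraph.dist_le (w.dropUntil z hz)
  have htake : (w.takeUntil z hz).length ≠ 0 :=
    fun h => hzx (SimpleGraph.Walk.eq_of_length_eq_zero h).symm
  omega

/-- If `l` vanishes at `r` and `d` is given by maxima of labels, then the distance
set is the range of `l`. -/
theorem distSet_eq_range_of_eq_max {X : Type*} {d : X → X → NNReal} {l : X → NNReal} {r : X}
    (hr : l r = 0) (hd₀ : ∀ x, d x x = 0) (hd : ∀ x y, x ≠ y → d x y = max (l x) (l y)) :
    distSet d = Set.range l := by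
  ext a
  constructor
  · rintro ⟨x, y, rfl⟩
    by_cases hxy : x = y
    · exact ⟨r, by rw [hxy, hd₀, hr]⟩
    · rw [hd x y hxy]
      rcases max_choice (l x) (l y) with h | h <;> rw [h] <;> exact Set.mem_range_self _
  · rintro ⟨x, rfl⟩
    by_cases hxr : x = r
    · exact ⟨r, r, by rw [hd₀, hxr, hr]⟩
    · exact ⟨x, r, by rw [hd x r hxr, hr, max_eq_left zero_le]⟩

/-- A connected finite graph has a natural-valued injective labeling vanishing at some vertex and
strictly increasing with the distance from it. -/
theorem SimpleGraph.exists_injective_label_lt_of_dist_lt {V : Type*} [Fintype V] [Nonempty V]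
    (G : SimpleGraph V) :
    ∃ (r : V) (f : V → ℕ), Function.Injective f ∧ f r = 0 ∧
      ∀ x y, G.dist x r < G.dist y r → f x < f y := by
  have hpos : 0 < Fintype.card V := Fintype.card_pos
  let e := Fintype.equivFin V
  let r := e.symm ⟨0, hpos⟩
  let f : V → ℕ := fun v => Fintype.card V * G.dist v r + e v
  have hlt : ∀ x y, G.dist x r < G.dist y r → f x < f y := by
    intro x y h
    have hmul := Nat.mul_le_mul_left (Fintype.card V) (Nat.succ_le_of_lt h)
    have hx := (e x).isLt
    simp only [f]
    rw [Nat.mul_succ] at hmul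
    omega
  refine ⟨r, f, fun x y hxy => ?_, by simp [f, r], hlt⟩
  have hdist : G.dist x r = G.dist y r := by
    rcases lt_trichotomy (G.dist x r) (G.dist y r) with h | h | h
    · exact absurd hxy (hlt x y h).ne
    · exact h
    · exact absurd hxy (hlt y x h).ne'
  simp only [f, hdist] at hxy
  exact e.injective (Fin.ext (Nat.add_left_cancel hxy))

/-- Every finite tree `T` admits a non-degenerate labeling `l`
such that `(V(T), d_l)` is a GH-space and `d_l(x,y) = max {l x, l y}` for all
distinct vertices `x, y`. -/
theorem exists_nondegenerate_labeling_GH_of_tree {V : Type*} [Fintype V]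
    (T : SimpleGraph V) (hT : T.IsTree) :
    ∃ l : V → NNReal,
      (∀ u v : V, T.Adj u v → 0 < max (l u) (l v)) ∧
      (distSet (labelDist T l)).ncard = Fintype.card V ∧
      ∀ x y : V, x ≠ y → labelDist T l x y = max (l x) (l y) := by
  have := hT.connected.nonempty
  obtain ⟨r, f, hf, hr, hlt⟩ := T.exists_injective_label_lt_of_dist_lt
  let l : V → NNReal := fun v => f v
  have hl : Function.Injective l := Nat.cast_injective.comp hf
  have hlr : l r = 0 := by simp [l, hr]
  have hmax : ∀ x y : V, x ≠ y → labelDist T l x y = max (l x) (l y) := by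
    intro x y hxy
    refine labelDist_eq_max_of_walks (r := r) (fun x => ?_) hxy
    obtain ⟨w, hw⟩ := hT.connected.exists_walk_dist_lt r x
    refine ⟨w, fun z hz => ?_⟩
    rcases hw z hz with rfl | h
    · exact le_rfl
    · exact Nat.cast_le.2 (hlt z x h).le
  refine ⟨l, fun u v huv => ?_, ?_, hmax⟩
  · rw [pos_iff_ne_zero]
    intro h
    have hu : l u = 0 := le_antisymm (h ▸ le_max_left _ _) zero_le
    have hv : l v = 0 := le_antisymm (h ▸ le_max_right _ _) zero_le
    exact huv.ne (hl (hu.trans hv.symm))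
  · rw [distSet_eq_range_of_eq_max hlr (fun x => if_pos rfl) hmax, ← Set.image_univ,
      Set.ncard_image_of_injective _ hl, Set.ncard_univ, Nat.card_eq_fintype_card]
end

section
/- Let G be a finite connected simple graph. Then for every vertex labeling l : V(G) → ℝ≥0 the inequality |D(V(G))| ≤ |E(G)| + 1 holds, where D(V(G)) is the distance set of the pseudoultrametric space (V(G), d_l) with d_l generated by G(l). -/
/-- The maximum of a labeling over the vertices of a walk of positive length is the larger label
of the two ends of some edge. -/
theorem exists_edge_foldr_max_eq {V : Type*} {G : SimpleGraph V} (l : V → NNReal) {x y : V}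
    (p : G.Walk x y) (hp : ¬ p.Nil) :
    ∃ e ∈ G.edgeSet, (e.map l).sup = (p.support.map l).foldr max 0 := by
  induction p with
  | nil => simp at hp
  | @cons u v w h q ih =>
    cases q with
    | nil => exact ⟨s(u, v), h, by simp⟩
    | cons h' q =>
      obtain ⟨e, he, heq⟩ := ih (by simp)
      rcases le_total (l u) ((e.map l).sup) with hle | hle
      · refine ⟨e, he, ?_⟩
        rw [SimpleGraph.Walk.support_cons, List.map_cons, List.foldr_cons, ← heq,
          max_eq_right hle]
      · refine ⟨s(u, v), h, ?_⟩
        have hv : l v ≤ (e.map l).sup := by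
          rw [heq]
          simp
        rw [SimpleGraph.Walk.support_cons, List.map_cons, List.foldr_cons, ← heq,
          max_eq_left hle]
        simpa using hv.trans hle

/-- Every nonzero distance generated by a labeled graph is the larger label of the two ends of
some edge. -/
theorem distSet_labelDist_subset {V : Type*} [Finite V] {G : SimpleGraph V} (hc : G.Connected)
    (l : V → NNReal) :
    distSet (labelDist G l) ⊆ insert 0 ((fun e : Sym2 V => (e.map l).sup) '' G.edgeSet) := by
  classical
  rintro _ ⟨x, y, rfl⟩
  by_cases hxy : x = y
  · simp [labelDist, hxy]
  · right
    rw [labelDist, if_neg hxy]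
    have hsub : Set.range (fun p : {p : G.Walk x y // p.IsPath} =>
        (p.1.support.map l).foldr max 0) ⊆
          (fun e : Sym2 V => (e.map l).sup) '' G.edgeSet := by
      rintro _ ⟨p, rfl⟩
      exact exists_edge_foldr_max_eq l p.1 (SimpleGraph.Walk.not_nil_of_ne hxy)
    have : Nonempty {p : G.Walk x y // p.IsPath} := (hc x y).elim_path fun p => ⟨p⟩
    exact hsub ((Set.range_nonempty _).csInf_mem ((Set.toFinite _).subset hsub))

/-- For every finite connected labeled graph `G(l)`,
`|D(V(G))| ≤ |E(G)| + 1`. -/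
theorem distSet_card_le {V : Type*} [Fintype V] (G : SimpleGraph V)
    (hc : G.Connected) :
    ∀ l : V → NNReal,
      (distSet (labelDist G l)).ncard ≤ G.edgeSet.ncard + 1 := by
  intro l
  calc (distSet (labelDist G l)).ncard
      ≤ (insert 0 ((fun e : Sym2 V => (e.map l).sup) '' G.edgeSet)).ncard :=
        Set.ncard_le_ncard (distSet_labelDist_subset hc l) (Set.toFinite _)
    _ ≤ ((fun e : Sym2 V => (e.map l).sup) '' G.edgeSet).ncard + 1 := Set.ncard_insert_le _ _
    _ ≤ G.edgeSet.ncard + 1 := by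
        gcongr
        exact Set.ncard_image_le (Set.toFinite _)
end

section
/- Let G be a finite connected simple graph. Then there exists a vertex labeling l : V(G) → ℝ≥0 such that |D(V(G))| = |E(G)| + 1 (where D(V(G)) is the distance set of the pseudoultrametric space (V(G), d_l) generated by G(l)) if and only if G is a tree. -/
lemma List.le_foldr_max {α : Type*} [LinearOrder α] (b : α) {L : List α} {a : α} (h : a ∈ L) :
    a ≤ L.foldr max b := by
  induction L with
  | nil => simp at h
  | cons c L ih =>
    rcases List.mem_cons.1 h with rfl | h
    · exact le_max_left _ _
    · exact (ih h).trans (le_max_right _ _)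

lemma List.foldr_max_zero_mem {L : List NNReal} (h : L ≠ []) : L.foldr max 0 ∈ L := by
  induction L with
  | nil => exact absurd rfl h
  | cons c L ih =>
    rcases eq_or_ne L [] with rfl | hL
    · simp
    · rcases max_choice c (L.foldr max 0) with hm | hm
      · simp [hm]
      · simp [hm, ih hL]

section LabelDist

variable {V : Type*} {G : SimpleGraph V} {l : V → NNReal}

/-- The infimum defining `labelDist` is attained by some path. -/
lemma exists_isPath_labelDist_eq [Finite V] (hc : G.Connected) {x y : V} (hxy : x ≠ y) :
    ∃ p : G.Walk x y, p.IsPath ∧ labelDist G l x y = (p.support.map l).foldr max 0 := by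
  classical
  let f : {p : G.Walk x y // p.IsPath} → NNReal := fun p => (p.1.support.map l).foldr max 0
  have hne : Nonempty {p : G.Walk x y // p.IsPath} := by
    obtain ⟨p, hp⟩ := hc.exists_isPath x y
    exact ⟨⟨p, hp⟩⟩
  have hfin : (Set.range f).Finite := by
    refine (Set.finite_range l).subset ?_
    rintro _ ⟨p, rfl⟩
    obtain ⟨v, -, hv⟩ := List.mem_map.1
      (List.foldr_max_zero_mem (L := p.1.support.map l) (by simp))
    exact ⟨v, hv⟩
  obtain ⟨p, hp⟩ := (Set.range_nonempty f).csInf_mem hfin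
  exact ⟨p.1, p.2, by rw [labelDist, if_neg hxy]; exact hp.symm⟩

/-- Every positive distance is the label of a vertex other than a given one of least label. -/
lemma distSet_labelDist_subset_s13 [Finite V] (hc : G.Connected) {v₀ : V} (h₀ : ∀ v, l v₀ ≤ l v) :
    distSet (labelDist G l) ⊆ insert 0 (l '' {v₀}ᶜ) := by
  rintro _ ⟨x, y, rfl⟩
  rcases eq_or_ne x y with rfl | hxy
  · simp [labelDist]
  right
  obtain ⟨p, -, hp⟩ := exists_isPath_labelDist_eq (l := l) hc hxy
  rw [hp]
  obtain ⟨v, -, hv⟩ := List.mem_map.1 (List.foldr_max_zero_mem (L := p.support.map l) (by simp))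
  rcases eq_or_ne v v₀ with rfl | hvv
  · obtain ⟨w, hw, hwv⟩ : ∃ w ∈ p.support, w ≠ v := by
      rcases eq_or_ne x v with rfl | hx
      · exact ⟨y, p.end_mem_support, hxy.symm⟩
      · exact ⟨x, p.start_mem_support, hx⟩
    refine ⟨w, hwv, le_antisymm (List.le_foldr_max _ (List.mem_map_of_mem hw)) ?_⟩
    rw [← hv]
    exact h₀ w
  · exact ⟨v, hvv, hv⟩

lemma ncard_distSet_labelDist_le [Finite V] (hc : G.Connected) :
    (distSet (labelDist G l)).ncard ≤ Nat.card V := by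
  have := hc.nonempty
  obtain ⟨v₀, h₀⟩ := Finite.exists_min l
  calc (distSet (labelDist G l)).ncard
      ≤ (insert 0 (l '' {v₀}ᶜ)).ncard :=
        Set.ncard_le_ncard (distSet_labelDist_subset_s13 hc h₀) (Set.toFinite _)
    _ ≤ (l '' {v₀}ᶜ).ncard + 1 := Set.ncard_insert_le _ _
    _ ≤ ({v₀}ᶜ : Set V).ncard + 1 := by gcongr; exact Set.ncard_image_le
    _ = Nat.card V := by
      rw [← Set.ncard_add_ncard_compl {v₀}, Set.ncard_singleton, add_comm]

lemma labelDist_eq_of_adj [Finite V] (hc : G.Connected) {u v : V} (h : G.Adj u v)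
    (hl : l u ≤ l v) : labelDist G l u v = l v := by
  apply le_antisymm
  · rw [labelDist, if_neg h.ne]
    refine (ciInf_le (OrderBot.bddBelow _) ⟨h.toWalk, by simp [h.ne]⟩).trans ?_
    simp [hl]
  · obtain ⟨p, -, hp⟩ := exists_isPath_labelDist_eq (l := l) hc h.ne
    rw [hp]
    exact List.le_foldr_max _ (List.mem_map_of_mem p.end_mem_support)

lemma SimpleGraph.Connected.exists_adj_dist_lt (hc : G.Connected) {v w : V} (h : v ≠ w) :
    ∃ u, G.Adj u v ∧ G.dist u w < G.dist v w := by
  obtain ⟨p, hp⟩ := hc.exists_walk_length_eq_dist v w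
  cases p with
  | nil => exact absurd rfl h
  | cons ha q =>
    refine ⟨_, ha.symm, ?_⟩
    have := SimpleGraph.dist_le q
    rw [SimpleGraph.Walk.length_cons] at hp
    omega

/-- Labels that increase with the distance from a root realize `|V|` distances. -/
lemma exists_labeling_ncard_distSet_eq [Finite V] (hc : G.Connected) :
    ∃ l : V → NNReal, (distSet (labelDist G l)).ncard = Nat.card V := by
  obtain ⟨r⟩ := hc.nonempty
  let N := Nat.card V
  let e : V ≃ Fin N := Finite.equivFin V
  let m : V → ℕ := fun v => G.dist v r * N + e v
  have hm : Function.Injective m := by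
    intro v w hvw
    apply e.injective
    ext
    have := congrArg (· % N) hvw
    simpa only [m, Nat.mul_add_mod_self_right, Nat.mod_eq_of_lt (e _).isLt] using this
  have hlt : ∀ u v, G.dist u r < G.dist v r → m u < m v := by
    intro u v huv
    have h1 : (G.dist u r + 1) * N ≤ G.dist v r * N := Nat.mul_le_mul_right N huv
    have h2 := (e u).isLt
    simp only [m]
    linarith
  let l : V → NNReal := fun v => m v
  have hl : Function.Injective l := Nat.cast_injective.comp hm
  refine ⟨l, (ncard_distSet_labelDist_le hc).antisymm ?_⟩
  have hsub : insert 0 (l '' {r}ᶜ) ⊆ distSet (labelDist G l) := by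
    rintro _ (rfl | ⟨v, hv, rfl⟩)
    · exact ⟨r, r, by simp [labelDist]⟩
    · obtain ⟨u, hadj, hd⟩ := hc.exists_adj_dist_lt hv
      exact ⟨u, v, labelDist_eq_of_adj hc hadj (Nat.cast_le.2 (hlt u v hd).le)⟩
  have hzero : (0 : NNReal) ∉ l '' {r}ᶜ := by
    rintro ⟨v, hv, h⟩
    obtain ⟨u, -, hd⟩ := hc.exists_adj_dist_lt hv
    have := hlt u v hd
    have : m v = 0 := Nat.cast_eq_zero.1 h
    omega
  have hfin : (distSet (labelDist G l)).Finite := by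
    obtain ⟨v₀, h₀⟩ := @Finite.exists_min V NNReal _ ⟨r⟩ _ l
    exact (Set.toFinite _).subset (distSet_labelDist_subset_s13 hc h₀)
  calc Nat.card V = ({r}ᶜ : Set V).ncard + 1 := by
        rw [← Set.ncard_add_ncard_compl {r}, Set.ncard_singleton, add_comm]
    _ = (insert 0 (l '' {r}ᶜ)).ncard := by
      rw [Set.ncard_insert_of_notMem hzero, Set.ncard_image_of_injective _ hl]
    _ ≤ (distSet (labelDist G l)).ncard := Set.ncard_le_ncard hsub hfin

end LabelDist

/-- A finite connected simple graph `G` admits a labeling `l`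
with `|D(V(G))| = |E(G)| + 1` iff `G` is a tree. -/
theorem exists_labeling_distSet_card_eq_iff_isTree {V : Type*} [Fintype V]
    (G : SimpleGraph V) (hc : G.Connected) :
    (∃ l : V → NNReal,
        (distSet (labelDist G l)).ncard = G.edgeSet.ncard + 1) ↔
      G.IsTree := by
  rw [SimpleGraph.isTree_iff_connected_and_card, Nat.card_coe_set_eq]
  constructor
  · rintro ⟨l, hl⟩
    have h₁ := ncard_distSet_labelDist_le (l := l) hc
    have h₂ := hc.card_vert_le_card_edgeSet_add_one
    rw [Nat.card_coe_set_eq] at h₂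
    exact ⟨hc, by omega⟩
  · rintro ⟨-, h⟩
    rw [h]
    exact exists_labeling_ncard_distSet_eq hc
end

section
/- Let G be a finite connected simple graph. Then there exists a non-degenerate vertex labeling l : V(G) → ℝ≥0 such that (V(G), d_l) is a GH-space, i.e., |D(V(G))| = |V(G)|, where d_l is the ultrametric on V(G) generated by G(l). -/
/-- In a connected graph the vertices can be enumerated injectively, starting from `0` at a root,
so that every other vertex has a neighbor with a smaller number. -/
lemma SimpleGraph.Connected.exists_injective_neighbor_lt {V : Type*} [Fintype V]
    {G : SimpleGraph V} (hc : G.Connected) (r : V) :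
    ∃ f : V → ℕ, Function.Injective f ∧ f r = 0 ∧ ∀ v, v ≠ r → ∃ u, G.Adj v u ∧ f u < f v := by
  classical
  set n := Fintype.card V
  let e := Fintype.equivFin V
  have dist_pos : ∀ v, v ≠ r → 0 < G.dist v r := fun v hv => hc.pos_dist_of_ne hv
  let f : V → ℕ := fun v => if v = r then 0 else G.dist v r * n + e v
  have f_root : f r = 0 := if_pos rfl
  have f_ne : ∀ v, v ≠ r → f v = G.dist v r * n + e v := fun v hv => if_neg hv
  have le_f : ∀ v, v ≠ r → n ≤ f v := fun v hv => by
    rw [f_ne v hv]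
    nlinarith [dist_pos v hv]
  have n_pos : 0 < n := (e r).pos
  have f_mod : ∀ v, v ≠ r → f v % n = e v := fun v hv => by
    rw [f_ne v hv, Nat.mul_add_mod_self_right, Nat.mod_eq_of_lt (e v).isLt]
  refine ⟨f, fun v w h => ?_, f_root, fun v hv => ?_⟩
  · by_cases hv : v = r <;> by_cases hw : w = r
    · rw [hv, hw]
    · have := le_f w hw
      rw [← h, hv, f_root] at this
      omega
    · have := le_f v hv
      rw [h, hw, f_root] at this
      omega
    · exact e.injective (Fin.ext (by rw [← f_mod v hv, h, f_mod w hw]))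
  · obtain ⟨p, hp⟩ := hc.exists_walk_length_eq_dist v r
    cases p with
    | nil => exact absurd rfl hv
    | @cons _ u _ h q =>
      refine ⟨u, h, ?_⟩
      by_cases hu : u = r
      · rw [hu, f_root]
        exact n_pos.trans_le (le_f v hv)
      · have hlt : G.dist u r + 1 ≤ G.dist v r := by
          rw [← hp, SimpleGraph.Walk.length_cons]
          exact Nat.succ_le_succ (SimpleGraph.dist_le q)
        rw [f_ne u hu, f_ne v hv]
        nlinarith [(e u).isLt, Nat.mul_le_mul_right n hlt]

lemma foldr_max_zero_mem_range {V : Type*} {l : V → NNReal} (h0 : 0 ∈ Set.range l)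
    (L : List V) : (L.map l).foldr max 0 ∈ Set.range l := by
  induction L with
  | nil => exact h0
  | cons v L ih =>
    rw [List.map_cons, List.foldr_cons]
    rcases max_choice (l v) ((L.map l).foldr max 0) with h | h <;> rw [h]
    · exact ⟨v, rfl⟩
    · exact ih

/-- If some vertex has label `0`, all distances are labels. -/
lemma labelDist_mem_range {V : Type*} [Finite V] {G : SimpleGraph V} (hc : G.Connected)
    {l : V → NNReal} (h0 : 0 ∈ Set.range l) (x y : V) : labelDist G l x y ∈ Set.range l := by
  unfold labelDist
  split_ifs
  · exact h0
  · obtain ⟨p, hp⟩ := hc.exists_isPath x y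
    have hsub : Set.range (fun p : {p : G.Walk x y // p.IsPath} =>
        (p.1.support.map l).foldr max 0) ⊆ Set.range l := by
      rintro _ ⟨p, rfl⟩
      exact foldr_max_zero_mem_range h0 _
    exact hsub (Set.Nonempty.csInf_mem ⟨_, ⟨p, hp⟩, rfl⟩ ((Set.finite_range l).subset hsub))

/-- The distance between adjacent vertices is the larger of their labels. -/
lemma labelDist_of_adj {V : Type*} {G : SimpleGraph V} {l : V → NNReal} {v u : V}
    (h : G.Adj v u) (hl : l u ≤ l v) : labelDist G l v u = l v := by
  unfold labelDist
  rw [if_neg h.ne]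
  let e : {p : G.Walk v u // p.IsPath} := ⟨h.toWalk, by simp [h.ne]⟩
  have : Nonempty {p : G.Walk v u // p.IsPath} := ⟨e⟩
  apply le_antisymm
  · exact (ciInf_le (OrderBot.bddBelow _) e).trans (by simp [e, hl])
  · refine le_ciInf fun ⟨p, _⟩ => ?_
    cases p <;> simp

/-- Every finite connected simple graph `G` admits a
non-degenerate labeling `l` such that `(V(G), d_l)` is a GH-space,
i.e. `|D(V(G))| = |V(G)|`. -/
theorem exists_nondegenerate_labeling_GH {V : Type*} [Fintype V]
    (G : SimpleGraph V) (hc : G.Connected) :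
    ∃ l : V → NNReal,
      (∀ u v : V, G.Adj u v → 0 < max (l u) (l v)) ∧
      (distSet (labelDist G l)).ncard = Fintype.card V := by
  obtain ⟨r⟩ := hc.nonempty
  obtain ⟨f, f_inj, f_root, f_lt⟩ := hc.exists_injective_neighbor_lt r
  let l : V → NNReal := fun v => f v
  have l_inj : Function.Injective l := Nat.cast_injective.comp f_inj
  have l_root : l r = 0 := by simp [l, f_root]
  refine ⟨l, fun u v h => ?_, ?_⟩
  · refine pos_iff_ne_zero.2 fun h0 => h.ne (l_inj ?_)
    have hu := le_max_left (l u) (l v)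
    have hv := le_max_right (l u) (l v)
    rw [h0, nonpos_iff_eq_zero] at hu hv
    rw [hu, hv]
  · have : distSet (labelDist G l) = Set.range l := by
      apply Set.Subset.antisymm
      · rintro _ ⟨x, y, rfl⟩
        exact labelDist_mem_range hc ⟨r, l_root⟩ x y
      · rintro _ ⟨v, rfl⟩
        by_cases hv : v = r
        · exact ⟨r, r, by rw [hv, l_root, labelDist, if_pos rfl]⟩
        · obtain ⟨u, h, hlt⟩ := f_lt v hv
          exact ⟨v, u, labelDist_of_adj h (Nat.cast_le.2 hlt.le)⟩
    rw [this, ← Set.image_univ, Set.ncard_image_of_injective _ l_inj, Set.ncard_univ,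
      Nat.card_eq_fintype_card]
end

section
/- There exist a connected simple graph G (which is not locally finite) and a non-degenerate vertex labeling l : V(G) → ℝ≥0 such that the pseudoultrametric d_l generated by G(l) is not an ultrametric. Concretely, for the graph G with vertex set {x, y} ∪ {z_n : n ∈ ℕ} and edge set {{x, z_n} : n ∈ ℕ} ∪ {{y, z_n} : n ∈ ℕ}, and the labeling l(x) = l(y) = 0 and l(z_n) = 1/n for each n ∈ ℕ, the labeling l is non-degenerate but d_l(x,y) = 0 with x ≠ y. -/
/-- The graph `G` with vertices `x = Sum.inl true`, `y = Sum.inl false` and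
`z_n = Sum.inr n` for `n ∈ ℕ` (`n ≥ 1`), whose edges are exactly
`{x, z_n}` and `{y, z_n}` for all `n`. -/
def doubleStar : SimpleGraph (Bool ⊕ ℕ+) :=
  SimpleGraph.fromRel (fun a b => (∃ s, a = Sum.inl s) ∧ ∃ n, b = Sum.inr n)

/-- The labeling `l x = l y = 0`, `l z_n = 1/n`. -/
noncomputable def doubleStarLabel : Bool ⊕ ℕ+ → NNReal :=
  fun a => match a with
  | Sum.inl _ => 0
  | Sum.inr n => ((n : ℕ) : NNReal)⁻¹

theorem doubleStar_adj_inl_inr (s : Bool) (n : ℕ+) :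
    doubleStar.Adj (Sum.inl s) (Sum.inr n) := by
  simp [doubleStar]

theorem doubleStar_connected : doubleStar.Connected := by
  have reach (v : Bool ⊕ ℕ+) : doubleStar.Reachable (Sum.inr 1) v := by
    rcases v with s | n
    · exact (doubleStar_adj_inl_inr s 1).symm.reachable
    · exact (doubleStar_adj_inl_inr true 1).symm.reachable.trans
        (doubleStar_adj_inl_inr true n).reachable
  exact ⟨fun u v => (reach u).symm.trans (reach v)⟩

theorem infinite_neighborSet_doubleStar (s : Bool) :
    (doubleStar.neighborSet (Sum.inl s)).Infinite :=
  (Set.infinite_range_of_injective Sum.inr_injective).mono <| by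
    rintro _ ⟨n, rfl⟩
    exact doubleStar_adj_inl_inr s n

theorem doubleStarLabel_inr_pos (n : ℕ+) : 0 < doubleStarLabel (Sum.inr n) := by
  simp [doubleStarLabel]

theorem doubleStarLabel_nondegenerate {u v : Bool ⊕ ℕ+} (h : doubleStar.Adj u v) :
    0 < max (doubleStarLabel u) (doubleStarLabel v) := by
  rw [doubleStar, SimpleGraph.fromRel_adj] at h
  obtain ⟨-, ⟨-, n, rfl⟩ | ⟨-, n, rfl⟩⟩ := h
  · exact lt_max_of_lt_right (doubleStarLabel_inr_pos n)
  · exact lt_max_of_lt_left (doubleStarLabel_inr_pos n)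

theorem labelDist_le_of_isPath {V : Type*} {G : SimpleGraph V} (l : V → NNReal) {x y : V}
    {p : G.Walk x y} (hp : p.IsPath) :
    labelDist G l x y ≤ (p.support.map l).foldr max 0 := by
  rw [labelDist]
  split_ifs
  · exact zero_le
  · exact ciInf_le (f := fun q : {q : G.Walk x y // q.IsPath} => (q.1.support.map l).foldr max 0)
      (OrderBot.bddBelow _) ⟨p, hp⟩

theorem labelDist_doubleStar_le (n : ℕ+) :
    labelDist doubleStar doubleStarLabel (Sum.inl true) (Sum.inl false) ≤
      ((n : ℕ) : NNReal)⁻¹ := by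
  let p : doubleStar.Walk (Sum.inl true) (Sum.inl false) :=
    .cons (doubleStar_adj_inl_inr true n) (.cons (doubleStar_adj_inl_inr false n).symm .nil)
  have hp : p.IsPath := by simp [p, SimpleGraph.Walk.isPath_def]
  simpa [p, doubleStarLabel] using labelDist_le_of_isPath doubleStarLabel hp

theorem labelDist_doubleStar_eq_zero :
    labelDist doubleStar doubleStarLabel (Sum.inl true) (Sum.inl false) = 0 := by
  by_contra h
  obtain ⟨n, hn⟩ := exists_nat_gt
    (labelDist doubleStar doubleStarLabel (Sum.inl true) (Sum.inl false))⁻¹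
  have hn0 : 0 < n := by exact_mod_cast (zero_le.trans_lt hn)
  exact (labelDist_doubleStar_le ⟨n, hn0⟩).not_gt (inv_lt_of_inv_lt₀ (pos_iff_ne_zero.mpr h) hn)

/-- There is a connected, not locally finite graph with a
non-degenerate labeling whose generated pseudoultrametric `d_l` is not an
ultrametric: for the double star graph with `l x = l y = 0`, `l z_n = 1/n`,
the labeling is non-degenerate but `d_l(x,y) = 0` although `x ≠ y`. -/
theorem doubleStar_not_ultrametric :
    doubleStar.Connected ∧
    (∃ v, (doubleStar.neighborSet v).Infinite) ∧
    (∀ u v, doubleStar.Adj u v →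
      0 < max (doubleStarLabel u) (doubleStarLabel v)) ∧
    (Sum.inl true : Bool ⊕ ℕ+) ≠ Sum.inl false ∧
    labelDist doubleStar doubleStarLabel (Sum.inl true) (Sum.inl false) = 0 :=
  ⟨doubleStar_connected, ⟨_, infinite_neighborSet_doubleStar true⟩,
    fun _ _ => doubleStarLabel_nondegenerate, by simp,
    labelDist_doubleStar_eq_zero⟩
end

section
/- There exists a connected simple graph H that is not locally finite such that, for every non-degenerate vertex labeling l : V(H) → ℝ≥0, the distance d_l generated by H(l) is an ultrametric on V(H). Concretely, the graph H with vertex set {y} ∪ {x_n : n ∈ ℤ} and edge set {{x_n, x_{n+1}} : n ∈ ℤ} ∪ {{y, x_n} : n ∈ ℤ} has this property, and the vertex y has infinite degree in H. -/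
/-- The graph `H` with vertices `y = none` and `x_n = some n` for `n ∈ ℤ`,
whose edges are exactly `{x_n, x_{n+1}}` and `{y, x_n}` for all `n ∈ ℤ`
(the union of a star and a double ray). -/
def starRay : SimpleGraph (Option ℤ) :=
  SimpleGraph.fromRel (fun a b =>
    (∃ n : ℤ, a = some n ∧ b = some (n + 1)) ∨
    (a = none ∧ ∃ n : ℤ, b = some n))

theorem foldr_max_lt_iff {L : List NNReal} {c : NNReal} (hc : 0 < c) :
    L.foldr max 0 < c ↔ ∀ a ∈ L, a < c := by
  induction L with
  | nil => simpa using hc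
  | cons a L ih => simp [ih]

section LabelDist

variable {V : Type*} {G : SimpleGraph V} {l : V → NNReal}

theorem labelDist_self (x : V) : labelDist G l x x = 0 := by simp [labelDist]

theorem labelDist_lt_iff (hG : G.Connected) {x y : V} (hxy : x ≠ y) {c : NNReal} (hc : 0 < c) :
    labelDist G l x y < c ↔ ∃ p : G.Walk x y, ∀ v ∈ p.support, l v < c := by
  classical
  rw [labelDist, if_neg hxy]
  constructor
  · intro h
    obtain ⟨p₀⟩ := hG.preconnected x y
    have : Nonempty {p : G.Walk x y // p.IsPath} := ⟨⟨p₀.bypass, p₀.bypass_isPath⟩⟩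
    obtain ⟨p, hp⟩ := exists_lt_of_ciInf_lt h
    exact ⟨p.1, fun v hv => (foldr_max_lt_iff hc).mp hp _ (List.mem_map_of_mem hv)⟩
  · rintro ⟨p, hp⟩
    refine (ciInf_le (OrderBot.bddBelow _) ⟨p.bypass, p.bypass_isPath⟩).trans_lt ?_
    rw [foldr_max_lt_iff hc]
    intro a ha
    obtain ⟨v, hv, rfl⟩ := List.mem_map.mp ha
    exact hp v (p.support_bypass_subset_support hv)

theorem labelDist_le_comm (hG : G.Connected) (x y : V) :
    labelDist G l x y ≤ labelDist G l y x := by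
  rcases eq_or_ne x y with rfl | hxy
  · exact le_rfl
  refine le_of_forall_gt fun c hc => ?_
  have hc0 : 0 < c := zero_le.trans_lt hc
  obtain ⟨p, hp⟩ := (labelDist_lt_iff hG hxy.symm hc0).mp hc
  exact (labelDist_lt_iff hG hxy hc0).mpr ⟨p.reverse, fun v hv => hp v (by simpa using hv)⟩

theorem labelDist_comm (hG : G.Connected) (x y : V) : labelDist G l x y = labelDist G l y x :=
  (labelDist_le_comm hG x y).antisymm (labelDist_le_comm hG y x)

theorem labelDist_le_max (hG : G.Connected) (x y z : V) :
    labelDist G l x y ≤ max (labelDist G l x z) (labelDist G l z y) := by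
  rcases eq_or_ne x y with rfl | hxy
  · simp [labelDist_self]
  rcases eq_or_ne x z with rfl | hxz
  · exact le_max_right _ _
  rcases eq_or_ne z y with rfl | hzy
  · exact le_max_left _ _
  refine le_of_forall_gt fun c hc => ?_
  have hc0 : 0 < c := zero_le.trans_lt hc
  obtain ⟨h₁, h₂⟩ := max_lt_iff.mp hc
  obtain ⟨p, hp⟩ := (labelDist_lt_iff hG hxz hc0).mp h₁
  obtain ⟨q, hq⟩ := (labelDist_lt_iff hG hzy hc0).mp h₂
  refine (labelDist_lt_iff hG hxy hc0).mpr ⟨p.append q, fun v hv => ?_⟩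
  rcases (SimpleGraph.Walk.mem_support_append_iff p q).mp hv with h | h
  exacts [hp v h, hq v h]

theorem labelDist_pos (hG : G.Connected) {x y : V} (hxy : x ≠ y) {c : NNReal} (hc : 0 < c)
    (h : ∀ p : G.Walk x y, ∃ v ∈ p.support, c ≤ l v) : 0 < labelDist G l x y := by
  refine hc.trans_le (not_lt.mp fun hlt => ?_)
  obtain ⟨p, hp⟩ := (labelDist_lt_iff hG hxy hc).mp hlt
  obtain ⟨v, hv, hcv⟩ := h p
  exact (hp v hv).not_ge hcv

end LabelDist

theorem starRay_adj_none_some (n : ℤ) : starRay.Adj none (some n) := by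
  simp [starRay]

theorem starRay_adj_succ (n : ℤ) : starRay.Adj (some n) (some (n + 1)) := by
  simp [starRay]

theorem eq_of_starRay_adj_some {n : ℤ} {v : Option ℤ} (h : starRay.Adj (some n) v) :
    v = none ∨ v = some (n + 1) ∨ v = some (n - 1) := by
  rcases v with _ | m
  · exact Or.inl rfl
  · simp only [starRay, SimpleGraph.fromRel_adj, ne_eq, Option.some.injEq, reduceCtorEq,
      false_and, or_false, exists_eq_left'] at h
    simp only [reduceCtorEq, Option.some.injEq, false_or]
    grind

theorem starRay_connected : starRay.Connected := by
  have h : ∀ v, starRay.Reachable none v := by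
    rintro (_ | n)
    · exact .refl _
    · exact (starRay_adj_none_some n).reachable
  exact { preconnected := fun u v => (h u).symm.trans (h v), nonempty := ⟨none⟩ }

theorem starRay_neighborSet_none_infinite : (starRay.neighborSet none).Infinite :=
  (Set.infinite_range_of_injective (Option.some_injective ℤ)).mono <| by
    rintro _ ⟨n, rfl⟩
    exact starRay_adj_none_some n

theorem starRay_labelDist_pos {l : Option ℤ → NNReal}
    (hl : ∀ u v, starRay.Adj u v → 0 < max (l u) (l v)) {x y : Option ℤ} (hxy : x ≠ y) :
    0 < labelDist starRay l x y := by
  by_cases hx : 0 < l x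
  · exact labelDist_pos starRay_connected hxy hx fun p => ⟨x, p.start_mem_support, le_rfl⟩
  by_cases hy : 0 < l y
  · exact labelDist_pos starRay_connected hxy hy fun p => ⟨y, p.end_mem_support, le_rfl⟩
  rcases x with _ | m
  · rcases y with _ | n
    · exact absurd rfl hxy
    · have := hl _ _ (starRay_adj_none_some n)
      simp_all
  have hpos : ∀ v, starRay.Adj (some m) v → 0 < l v := fun v hv =>
    (lt_max_iff.mp (hl _ _ hv)).resolve_left hx
  have h₀ := hpos _ (starRay_adj_none_some m).symm
  have h₁ := hpos _ (starRay_adj_succ m)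
  have h₂ := hpos (some (m - 1)) (by simpa using (starRay_adj_succ (m - 1)).symm)
  refine labelDist_pos starRay_connected hxy (lt_min h₀ (lt_min h₁ h₂)) fun p => ?_
  cases p with
  | nil => exact absurd rfl hxy
  | @cons _ v _ h p =>
    refine ⟨v, by simp, ?_⟩
    rcases eq_of_starRay_adj_some h with rfl | rfl | rfl <;> simp

/-- There is a connected graph `H` that is not locally finite
such that for every non-degenerate labeling `l` the distance `d_l` generated
by `H(l)` is an ultrametric: the union of a star and a double ray has this
property, its center `y = none` having infinite degree. -/
theorem starRay_ultrametric_for_all_nondegenerate :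
    starRay.Connected ∧
    (starRay.neighborSet none).Infinite ∧
    ∀ l : Option ℤ → NNReal,
      (∀ u v, starRay.Adj u v → 0 < max (l u) (l v)) →
      ((∀ x y, labelDist starRay l x y = labelDist starRay l y x) ∧
       (∀ x y, labelDist starRay l x y = 0 ↔ x = y) ∧
       (∀ x y z, labelDist starRay l x y ≤
          max (labelDist starRay l x z) (labelDist starRay l z y))) := by
  refine ⟨starRay_connected, starRay_neighborSet_none_infinite, fun l hl =>
    ⟨labelDist_comm starRay_connected, fun x y => ⟨fun h => ?_, ?_⟩,
      labelDist_le_max starRay_connected⟩⟩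
  · by_contra hxy
    exact (starRay_labelDist_pos hl hxy).ne' h
  · rintro rfl
    exact labelDist_self x
end
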